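/- arXiv:1804.00427 — 2 statements merged into one kernel-verified Lean document; each statement's English description precedes it below -/
import Mathlib

section
/- Let (X, d) be a metric space, let S be a subset of Baire space ℕ → ℕ (with the subspace topology induced by the Baire-space metric u), and let q : S → X be a surjection such that the map S × S → ℝ sending (s, t) to d(q(s), q(t)) is continuous. Then X is separable. -/
/-- if `(X, d)` is a metric space, `S` a subset of Baire space
`ℕ → ℕ` (with the subspace topology induced by the Baire-space metric `u`, which
coincides with the subspace topology from the product topology on `ℕ → ℕ` with `ℕ`
discrete), and `q : S → X` a surjection such that `(s, t) ↦ d(q s, q t)` is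
continuous, then `X` is separable: there is a countable `D ⊆ X` such that for all
`x : X` and `k : ℕ` there is `y ∈ D` with `d(x,y) ≤ 2⁻ᵏ`. -/
theorem separable_of_quotient_of_baire_subset
    {X : Type*} [MetricSpace X] (S : Set (ℕ → ℕ)) (q : S → X)
    (hq : Function.Surjective q)
    (hc : Continuous fun p : S × S => dist (q p.1) (q p.2)) :
    ∃ D : Set X, D.Countable ∧
      ∀ x : X, ∀ k : ℕ, ∃ y ∈ D, dist x y ≤ (2 : ℝ)⁻¹ ^ k := by
  have hqc : Continuous q := by
    refine continuous_iff_continuousAt.2 fun a => tendsto_iff_dist_tendsto_zero.2 ?_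
    have h : Continuous fun s : S => dist (q s) (q a) :=
      hc.comp (continuous_id.prodMk continuous_const)
    simpa using h.tendsto a
  have hX : TopologicalSpace.SeparableSpace X := hq.denseRange.separableSpace hqc
  obtain ⟨D, hD, hdense⟩ := TopologicalSpace.exists_countable_dense X
  refine ⟨D, hD, fun x k => ?_⟩
  obtain ⟨y, hy, hxy⟩ := hdense.exists_dist_lt x (ε := (2 : ℝ)⁻¹ ^ k) (by positivity)
  exact ⟨y, hy, hxy.le⟩
end

section
/- Suppose that (i) every subset S of ℕ is countable, in the sense that there exists f : ℕ → Option ℕ with (∀ n m, f(n) = some m → m ∈ S) and (∀ m ∈ S, ∃ n, f(n) = some m); and (ii) Markov's principle holds: for every g : ℕ → Bool, if ¬¬(∃ n, g(n) = true) then ∃ n, g(n) = true. Then excluded middle holds: for every proposition p, p ∨ ¬p. (This implication is provable intuitionistically, i.e., without using classical axioms.) -/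
/-- if every subset of `ℕ` is countable (enumerable by some
`f : ℕ → Option ℕ` whose `some`-values are exactly the elements of the subset)
and Markov's principle holds, then excluded middle holds. -/
theorem em_of_all_subsets_countable_of_markov
    (hcount : ∀ S : Set ℕ, ∃ f : ℕ → Option ℕ,
      (∀ n m : ℕ, f n = some m → m ∈ S) ∧ (∀ m ∈ S, ∃ n, f n = some m))
    (markov : ∀ g : ℕ → Bool, ¬¬(∃ n, g n = true) → ∃ n, g n = true) :
    ∀ p : Prop, p ∨ ¬p := by
  intro p
  obtain ⟨f, hf_mem, hf_surj⟩ := hcount {m | (m = 0 ∧ p) ∨ (m = 1 ∧ ¬p)}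
  have enumerates : ∀ m, (m = 0 ∧ p) ∨ (m = 1 ∧ ¬p) → ∃ n, (f n).isSome = true := by
    intro m hm
    obtain ⟨n, hn⟩ := hf_surj m hm
    exact ⟨n, congrArg Option.isSome hn⟩
  obtain ⟨n, hn⟩ := markov (fun n => (f n).isSome) fun h =>
    h (enumerates 1 (Or.inr ⟨rfl, fun hp => h (enumerates 0 (Or.inl ⟨rfl, hp⟩))⟩))
  obtain ⟨m, hm⟩ := Option.isSome_iff_exists.mp hn
  exact (hf_mem n m hm).imp And.right And.right
end
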